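/- Let κ > 0, η > 0, r > 0, c > 0 and θ ∈ ℝ. Let F(z) = ∫₀^∞ υ^{r/κ − 1} exp(√(2κ/η²)(z − θ)υ − υ²/2) dυ, let b ∈ ℝ be the unique solution of (1 − e^{−c e^{b}}) F'(b) = c e^{b} e^{−c e^{b}} F(b), and let ζ ∈ ℝ be the unique root of h(z) = (η²/2)(1 − c e^z) + κ(θ − z) − r(e^{c e^z} − 1)/(c e^z). Then b > ζ; consequently h(z) < 0, i.e., (η²/2)(1 − c e^z) + κ(θ − z) < r(e^{c e^z} − 1)/(c e^z), for every z ≥ b. -/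

import Mathlib

/-- The increasing solution F of the OU ODE. -/
noncomputable def ouF (κ θ η r : ℝ) (z : ℝ) : ℝ :=
  ∫ υ in Set.Ioi (0:ℝ),
    υ ^ (r/κ - 1) * Real.exp (Real.sqrt (2*κ/η^2) * (z - θ) * υ - υ^2/2)

open Real Set Filter Topology MeasureTheory

/-- The parabolic cylinder type integral `∫₀^∞ v ^ p * exp (x v - v² / 2) dv`. -/
noncomputable def gaussMoment (p x : ℝ) : ℝ :=
  ∫ v in Ioi (0 : ℝ), v ^ p * exp (x * v - v ^ 2 / 2)

lemma rpow_mul_exp_le {p x M v : ℝ} (hx : |x| ≤ M) (hv : 0 < v) :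
    v ^ p * exp (x * v - v ^ 2 / 2) ≤ exp (M ^ 2) * (v ^ p * exp (-(1 / 4) * v ^ 2)) := by
  have h1 : x * v ≤ M * v := by
    gcongr
    exact (le_abs_self x).trans hx
  have h2 : exp (x * v - v ^ 2 / 2) ≤ exp (M ^ 2) * exp (-(1 / 4) * v ^ 2) := by
    rw [← exp_add]
    apply exp_le_exp.2
    nlinarith [sq_nonneg (M - v / 2)]
  calc v ^ p * exp (x * v - v ^ 2 / 2)
      ≤ v ^ p * (exp (M ^ 2) * exp (-(1 / 4) * v ^ 2)) := by gcongr
    _ = _ := by ring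

lemma integrableOn_gauss_bound {p : ℝ} (hp : -1 < p) (M : ℝ) :
    IntegrableOn (fun v : ℝ => exp (M ^ 2) * (v ^ p * exp (-(1 / 4) * v ^ 2))) (Ioi 0) :=
  ((integrable_rpow_mul_exp_neg_mul_sq (by norm_num) hp).const_mul _).integrableOn

lemma aestronglyMeasurable_gaussMoment_integrand (p x : ℝ) :
    AEStronglyMeasurable (fun v : ℝ => v ^ p * exp (x * v - v ^ 2 / 2))
      (volume.restrict (Ioi 0)) :=
  Measurable.aestronglyMeasurable (by fun_prop)

lemma integrableOn_gaussMoment {p : ℝ} (hp : -1 < p) (x : ℝ) :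
    IntegrableOn (fun v : ℝ => v ^ p * exp (x * v - v ^ 2 / 2)) (Ioi 0) := by
  refine (integrableOn_gauss_bound hp |x|).mono'
    (aestronglyMeasurable_gaussMoment_integrand p x) ?_
  filter_upwards [ae_restrict_mem measurableSet_Ioi] with v (hv : 0 < v)
  rw [norm_of_nonneg (by positivity)]
  exact rpow_mul_exp_le le_rfl hv

lemma hasDerivAt_gaussMoment {p : ℝ} (hp : -1 < p) (x : ℝ) :
    HasDerivAt (gaussMoment p) (gaussMoment (p + 1) x) x := by
  refine (hasDerivAt_integral_of_dominated_loc_of_deriv_le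
    (F := fun y v => v ^ p * exp (y * v - v ^ 2 / 2))
    (F' := fun y v => v ^ (p + 1) * exp (y * v - v ^ 2 / 2))
    (Metric.ball_mem_nhds x one_pos)
    (Eventually.of_forall fun y => aestronglyMeasurable_gaussMoment_integrand p y)
    (integrableOn_gaussMoment hp x)
    (aestronglyMeasurable_gaussMoment_integrand (p + 1) x) ?_
    (integrableOn_gauss_bound (p := p + 1) (by linarith) (|x| + 1)) ?_).2
  · filter_upwards [ae_restrict_mem measurableSet_Ioi] with v (hv : 0 < v) y hy
    rw [norm_of_nonneg (by positivity)]
    refine rpow_mul_exp_le ?_ hv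
    rw [Metric.mem_ball, Real.dist_eq] at hy
    have := abs_add_le (y - x) x
    rw [sub_add_cancel] at this
    linarith
  · filter_upwards [ae_restrict_mem measurableSet_Ioi] with v (hv : 0 < v) y _
    have h := (((hasDerivAt_id' y).mul_const v).sub_const (v ^ 2 / 2)).exp.const_mul (v ^ p)
    refine h.congr_deriv ?_
    rw [rpow_add_one hv.ne']
    ring

lemma gaussMoment_pos {p : ℝ} (hp : -1 < p) (x : ℝ) : 0 < gaussMoment p x := by
  refine (setIntegral_pos_iff_support_of_nonneg_ae ?_ (integrableOn_gaussMoment hp x)).2 ?_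
  · filter_upwards [ae_restrict_mem measurableSet_Ioi] with v (hv : 0 < v)
    show 0 ≤ v ^ p * exp (x * v - v ^ 2 / 2)
    positivity
  · have : Ioi (0 : ℝ) ⊆ Function.support (fun v : ℝ => v ^ p * exp (x * v - v ^ 2 / 2)) := by
      intro v (hv : 0 < v)
      exact (mul_pos (rpow_pos_of_pos hv p) (exp_pos _)).ne'
    rw [inter_eq_right.2 this]
    simp

lemma gaussMoment_mono {p : ℝ} (hp : -1 < p) : Monotone (gaussMoment p) :=
  monotone_of_hasDerivAt_nonneg (hasDerivAt_gaussMoment hp)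
    fun x => (gaussMoment_pos (by linarith) x).le

/-- Contiguous relation, by integrating the derivative of `v ^ a * exp (x v - v² / 2)`. -/
lemma gaussMoment_add_one {a : ℝ} (ha : 0 < a) (x : ℝ) :
    gaussMoment (a + 1) x = x * gaussMoment a x + a * gaussMoment (a - 1) x := by
  have i0 := (integrableOn_gaussMoment (p := a - 1) (by linarith) x).const_mul a
  have i1 := (integrableOn_gaussMoment (p := a) (by linarith) x)
  have i1' := i1.const_mul x
  have i2 := integrableOn_gaussMoment (p := a + 1) (by linarith) x
  have hd : ∀ v ∈ Ioi (0 : ℝ), HasDerivAt (fun v : ℝ => v ^ a * exp (x * v - v ^ 2 / 2))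
      (a * (v ^ (a - 1) * exp (x * v - v ^ 2 / 2)) + x * (v ^ a * exp (x * v - v ^ 2 / 2))
        - v ^ (a + 1) * exp (x * v - v ^ 2 / 2)) v := by
    intro v (hv : 0 < v)
    have h1 := hasDerivAt_rpow_const (x := v) (p := a) (Or.inl hv.ne')
    have h2 := (((hasDerivAt_id' v).const_mul x).sub
      ((hasDerivAt_pow 2 v).div_const 2)).exp
    refine (h1.mul h2).congr_deriv ?_
    simp only [Pi.sub_apply, rpow_add_one hv.ne']
    ring
  have hint := (i0.add i1').sub i2
  have hc : ContinuousWithinAt (fun v : ℝ => v ^ a * exp (x * v - v ^ 2 / 2)) (Ici 0) 0 :=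
    ((continuousAt_rpow_const 0 a (Or.inr ha.le)).mul (by fun_prop)).continuousWithinAt
  have key := integral_Ioi_of_hasDerivAt_of_tendsto hc hd hint
    (tendsto_zero_of_hasDerivAt_of_integrableOn_Ioi hd hint i1)
  rw [integral_sub (by exact i0.add i1') i2, integral_add i0 i1', integral_const_mul,
    integral_const_mul, zero_rpow ha.ne'] at key
  unfold gaussMoment
  linarith

lemma exp_sub_one_div_mono {a b : ℝ} (ha : 0 < a) (hab : a ≤ b) :
    (exp a - 1) / a ≤ (exp b - 1) / b := by
  simpa using convexOn_exp.secant_mono (mem_univ 0) (mem_univ a) (mem_univ b)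
    ha.ne' (ha.trans_le hab).ne' hab

/-- The function whose sign is that of `(L - r) (1 - exp (-c exp z))`. -/
noncomputable def xouH (κ θ η r c z : ℝ) : ℝ :=
  η ^ 2 / 2 * (1 - c * exp z) + κ * (θ - z) - r * (exp (c * exp z) - 1) / (c * exp z)

lemma strictAnti_xouH {κ η r c : ℝ} (θ : ℝ) (hκ : 0 < κ) (hr : 0 < r) (hc : 0 < c) :
    StrictAnti (xouH κ θ η r c) := by
  intro y z hyz
  have h1 : c * exp y ≤ c * exp z := by gcongr
  have h2 := mul_le_mul_of_nonneg_left
    (exp_sub_one_div_mono (mul_pos hc (exp_pos y)) h1) hr.le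
  have h3 := mul_le_mul_of_nonneg_left h1 (by positivity : 0 ≤ η ^ 2 / 2)
  have h4 := mul_lt_mul_of_pos_left hyz hκ
  simp only [xouH, mul_div_assoc]
  linarith

lemma ouF_eq (κ θ η r z : ℝ) :
    ouF κ θ η r z = gaussMoment (r / κ - 1) (sqrt (2 * κ / η ^ 2) * (z - θ)) := rfl

/-- The derivative of `ouF`. -/
noncomputable def ouF' (κ θ η r z : ℝ) : ℝ :=
  sqrt (2 * κ / η ^ 2) * gaussMoment (r / κ) (sqrt (2 * κ / η ^ 2) * (z - θ))

section

variable {κ η r : ℝ} (θ : ℝ)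

lemma ouF_pos (hκ : 0 < κ) (hr : 0 < r) (z : ℝ) : 0 < ouF κ θ η r z :=
  gaussMoment_pos (by linarith [div_pos hr hκ]) _

lemma ouF'_nonneg (hκ : 0 < κ) (hr : 0 < r) (z : ℝ) : 0 ≤ ouF' κ θ η r z :=
  mul_nonneg (sqrt_nonneg _) (gaussMoment_pos (by linarith [div_pos hr hκ]) _).le

lemma ouF'_mono (hκ : 0 < κ) (hr : 0 < r) : Monotone (ouF' κ θ η r) := by
  intro y z hyz
  refine mul_le_mul_of_nonneg_left ?_ (sqrt_nonneg _)
  apply gaussMoment_mono (by linarith [div_pos hr hκ])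
  gcongr

lemma hasDerivAt_ouF (hκ : 0 < κ) (hr : 0 < r) (z : ℝ) :
    HasDerivAt (ouF κ θ η r) (ouF' κ θ η r z) z := by
  have h := (hasDerivAt_gaussMoment (p := r / κ - 1) (by linarith [div_pos hr hκ])
    (sqrt (2 * κ / η ^ 2) * (z - θ))).comp z
    (((hasDerivAt_id' z).sub_const θ).const_mul (sqrt (2 * κ / η ^ 2)))
  refine h.congr_deriv ?_
  rw [sub_add_cancel, ouF']
  ring

/-- `ouF` solves the Ornstein-Uhlenbeck equation `(η² / 2) f'' + κ (θ - z) f' = r f`. -/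
lemma hasDerivAt_ouF' (hκ : 0 < κ) (hη : 0 < η) (hr : 0 < r) (z : ℝ) :
    HasDerivAt (ouF' κ θ η r)
      (2 / η ^ 2 * (r * ouF κ θ η r z - κ * (θ - z) * ouF' κ θ η r z)) z := by
  have h := ((hasDerivAt_gaussMoment (p := r / κ) (by linarith [div_pos hr hκ])
    (sqrt (2 * κ / η ^ 2) * (z - θ))).comp z
    (((hasDerivAt_id' z).sub_const θ).const_mul (sqrt (2 * κ / η ^ 2)))).const_mul
    (sqrt (2 * κ / η ^ 2))
  refine h.congr_deriv ?_
  rw [gaussMoment_add_one (div_pos hr hκ), ouF_eq, ouF']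
  have hs : sqrt (2 * κ / η ^ 2) ^ 2 = 2 * κ / η ^ 2 := sq_sqrt (by positivity)
  generalize sqrt (2 * κ / η ^ 2) = k at *
  generalize gaussMoment (r / κ) (k * (z - θ)) = A
  generalize gaussMoment (r / κ - 1) (k * (z - θ)) = B
  calc _ = k ^ 2 * (k * (z - θ) * A + r / κ * B) := by ring
    _ = _ := by
      rw [hs]
      field_simp
      ring

end

/-- The Wronskian of `1 - exp (-c exp z)` and `ouF`, weighted by the integrating factor of
the Ornstein-Uhlenbeck operator. -/
noncomputable def weightedWronskian (κ θ η r c z : ℝ) : ℝ :=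
  ((1 - exp (-(c * exp z))) * ouF' κ θ η r z
    - c * exp z * exp (-(c * exp z)) * ouF κ θ η r z) * exp (-(κ / η ^ 2) * (z - θ) ^ 2)

lemma hasDerivAt_weightedWronskian {κ η r c : ℝ} (θ : ℝ) (hκ : 0 < κ) (hη : 0 < η)
    (hr : 0 < r) (hc : 0 < c) (z : ℝ) :
    HasDerivAt (weightedWronskian κ θ η r c)
      (-(2 / η ^ 2 * exp (-(κ / η ^ 2) * (z - θ) ^ 2) * ouF κ θ η r z * (c * exp z)
        * exp (-(c * exp z)) * xouH κ θ η r c z)) z := by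
  have hy : HasDerivAt (fun z => c * exp z) (c * exp z) z := (hasDerivAt_exp z).const_mul c
  have hE : HasDerivAt (fun z => exp (-(c * exp z))) (exp (-(c * exp z)) * -(c * exp z)) z :=
    hy.neg.exp
  have hs : HasDerivAt (fun z => exp (-(κ / η ^ 2) * (z - θ) ^ 2))
      (exp (-(κ / η ^ 2) * (z - θ) ^ 2) * (-(κ / η ^ 2) * (2 * (z - θ)))) z := by
    refine ((((hasDerivAt_id' z).sub_const θ).pow 2).const_mul _).exp.congr_deriv ?_
    simp
  have h := (((hE.const_sub 1).mul (hasDerivAt_ouF' θ hκ hη hr z)).sub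
    ((hy.mul hE).mul (hasDerivAt_ouF (η := η) θ hκ hr z))).mul hs
  refine h.congr_deriv ?_
  have hpos : 0 < c * exp z := mul_pos hc (exp_pos z)
  have hEy : exp (c * exp z) = (exp (-(c * exp z)))⁻¹ := by rw [exp_neg, inv_inv]
  simp only [xouH, hEy, Pi.mul_apply, Pi.sub_apply]
  have hEpos := exp_pos (-(c * exp z))
  generalize exp (-(c * exp z)) = E at *
  generalize c * exp z = y at *
  field_simp
  ring

lemma weightedWronskian_le {κ η r c : ℝ} (θ : ℝ) (hκ : 0 < κ) (hr : 0 < r) (hc : 0 < c)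
    {z a : ℝ} (hza : z ≤ a) :
    weightedWronskian κ θ η r c z ≤
      ouF' κ θ η r a * exp (-(κ / η ^ 2) * (z - θ) ^ 2) := by
  refine mul_le_mul_of_nonneg_right ?_ (exp_pos _).le
  have h1 : 0 ≤ c * exp z * exp (-(c * exp z)) * ouF κ θ η r z :=
    mul_nonneg (by positivity) (ouF_pos θ hκ hr z).le
  have h2 : (1 - exp (-(c * exp z))) * ouF' κ θ η r z ≤ 1 * ouF' κ θ η r z :=
    mul_le_mul_of_nonneg_right (by linarith [exp_pos (-(c * exp z))]) (ouF'_nonneg θ hκ hr z)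
  linarith [ouF'_mono (η := η) θ hκ hr hza]

lemma tendsto_exp_neg_mul_sub_sq_atBot {a : ℝ} (ha : 0 < a) (θ : ℝ) :
    Tendsto (fun z : ℝ => exp (-a * (z - θ) ^ 2)) atBot (𝓝 0) := by
  refine tendsto_exp_atBot.comp (Tendsto.const_mul_atTop_of_neg (neg_neg_of_pos ha) ?_)
  have h : Tendsto (fun z : ℝ => z - θ) atBot atBot :=
    tendsto_atBot_add_const_right _ (-θ) tendsto_id
  simpa only [sq] using h.atBot_mul_atBot₀ h

/-- For κ, η, r, c > 0 and θ ∈ ℝ, if b solves the smooth-pasting equation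
(1 − e^{−c e^b})F'(b) = c e^b e^{−c e^b} F(b) and ζ is the root of
h(z) = (η²/2)(1 − c e^z) + κ(θ − z) − r(e^{c e^z} − 1)/(c e^z),
then b > ζ; consequently h < 0 on [b, ∞). -/
theorem xou_exp_threshold_above_root (κ θ η r c b ζ : ℝ)
    (hκ : 0 < κ) (hη : 0 < η) (hr : 0 < r) (hc : 0 < c)
    (hb : (1 - Real.exp (-(c * Real.exp b))) * deriv (ouF κ θ η r) b
      = c * Real.exp b * Real.exp (-(c * Real.exp b)) * ouF κ θ η r b)
    (hζ : η^2/2 * (1 - c * Real.exp ζ) + κ * (θ - ζ)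
      - r * (Real.exp (c * Real.exp ζ) - 1) / (c * Real.exp ζ) = 0) :
    ζ < b ∧
    ∀ z : ℝ, b ≤ z →
      η^2/2 * (1 - c * Real.exp z) + κ * (θ - z)
        < r * (Real.exp (c * Real.exp z) - 1) / (c * Real.exp z) := by
  have hanti : StrictAnti (xouH κ θ η r c) := strictAnti_xouH θ hκ hr hc
  have hζ0 : xouH κ θ η r c ζ = 0 := hζ
  have hlt : ζ < b := by
    by_contra! hbζ
    rw [(hasDerivAt_ouF θ hκ hr b).deriv] at hb
    have hb0 : weightedWronskian κ θ η r c b = 0 := by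
      rw [weightedWronskian, hb, sub_self, zero_mul]
    have hdec : StrictAntiOn (weightedWronskian κ θ η r c) (Iic b) := by
      have hd := hasDerivAt_weightedWronskian θ hκ hη hr hc
      refine strictAntiOn_of_deriv_neg (convex_Iic b)
        (fun z _ => (hd z).continuousAt.continuousWithinAt) fun z hz => ?_
      rw [interior_Iic, mem_Iio] at hz
      have hpos : 0 < xouH κ θ η r c z := hζ0 ▸ hanti (hz.trans_le hbζ)
      have hF := ouF_pos (η := η) θ hκ hr z
      rw [(hd z).deriv, neg_lt_zero]
      positivity
    have hpos : 0 < weightedWronskian κ θ η r c (b - 1) :=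
      hb0 ▸ hdec (mem_Iic.2 (by linarith)) (mem_Iic.2 le_rfl) (by linarith)
    have hlim := (tendsto_exp_neg_mul_sub_sq_atBot
      (div_pos hκ (pow_pos hη 2)) θ).const_mul (ouF' κ θ η r (b - 1))
    rw [mul_zero] at hlim
    refine hpos.not_ge (ge_of_tendsto hlim ?_)
    filter_upwards [eventually_le_atBot (b - 1)] with z hz
    exact (hdec.antitoneOn (mem_Iic.2 (by linarith)) (mem_Iic.2 (by linarith)) hz).trans
      (weightedWronskian_le θ hκ hr hc hz)
  refine ⟨hlt, fun z hz => ?_⟩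
  have h : xouH κ θ η r c z < 0 := hζ0 ▸ hanti (hlt.trans_le hz)
  exact sub_neg.1 h
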